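/- arXiv:0812.2668 — 2 statements merged into one kernel-verified Lean document; each statement's English description precedes it below -/
import Mathlib

section
/- Let 𝒜_1 and 𝒜_2 be complementary subalgebras of M_n(ℂ). Then 𝒜_1′ and 𝒜_2′ are complementary if and only if the set of products 𝒜_1 𝒜_2 linearly spans M_n(ℂ). -/
open Matrix BigOperators

/-- The commutant of a set of matrices. -/
def matCommutant {ι : Type*} [Fintype ι] [DecidableEq ι]
    (S : Set (Matrix ι ι ℂ)) : Set (Matrix ι ι ℂ) :=
  {X | ∀ A ∈ S, A * X = X * A}

/-- Two sets of matrices are complementary (quasi-orthogonal): the traceless parts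
(𝒜 ⊖ ℂI) and (ℬ ⊖ ℂI) are orthogonal for the Hilbert–Schmidt inner product,
equivalently Tr(A*B) = Tr(A*)·Tr(B)/n for all A ∈ 𝒜, B ∈ ℬ. -/
def Complementary {ι : Type*} [Fintype ι] [DecidableEq ι]
    (S T : Set (Matrix ι ι ℂ)) : Prop :=
  ∀ A ∈ S, ∀ B ∈ T, (Aᴴ * B).trace = Aᴴ.trace * B.trace / (Fintype.card ι : ℂ)

/-- `a` is a Parseval-type family for the set `S`. -/
structure HSFrame {n : ℕ} {ι : Type*} [Fintype ι] (S : Set (Matrix (Fin n) (Fin n) ℂ))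
    (a : ι → Matrix (Fin n) (Fin n) ℂ) : Prop where
  mem : ∀ i, a i ∈ S
  expand : ∀ X ∈ S, ∑ i, ((a i)ᴴ * X).trace • a i = X

/-- The completely positive map attached to a family. -/
def hsPhi {n : ℕ} {ι : Type*} [Fintype ι] (a : ι → Matrix (Fin n) (Fin n) ℂ)
    (X : Matrix (Fin n) (Fin n) ℂ) : Matrix (Fin n) (Fin n) ℂ :=
  ∑ i, a i * X * (a i)ᴴ

section
variable {n : ℕ} {ι κ : Type*} [Fintype ι] [Fintype κ]

lemma HSFrame.expand_star {S : Set (Matrix (Fin n) (Fin n) ℂ)}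
    {a : ι → Matrix (Fin n) (Fin n) ℂ} (h : HSFrame S a) (X : Matrix (Fin n) (Fin n) ℂ)
    (hX : X ∈ S) : ∑ i, (Xᴴ * a i).trace • (a i)ᴴ = Xᴴ := by
  conv_rhs => rw [← h.expand X hX]
  rw [conjTranspose_sum]
  refine Finset.sum_congr rfl fun i _ => ?_
  rw [conjTranspose_smul, ← trace_conjTranspose, conjTranspose_mul, conjTranspose_conjTranspose]

lemma HSFrame.phi_eq {S : Set (Matrix (Fin n) (Fin n) ℂ)}
    {a : ι → Matrix (Fin n) (Fin n) ℂ} {b : κ → Matrix (Fin n) (Fin n) ℂ}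
    (ha : HSFrame S a) (hb : HSFrame S b) (X : Matrix (Fin n) (Fin n) ℂ) :
    hsPhi a X = hsPhi b X := by
  unfold hsPhi
  calc ∑ i, a i * X * (a i)ᴴ
      = ∑ i, ∑ j, ((b j)ᴴ * a i).trace • (b j * X * (a i)ᴴ) := by
        refine Finset.sum_congr rfl fun i _ => ?_
        conv_lhs => enter [1, 1]; rw [← hb.expand _ (ha.mem i)]
        simp [Finset.sum_mul]
    _ = ∑ j, ∑ i, ((b j)ᴴ * a i).trace • (b j * X * (a i)ᴴ) := Finset.sum_comm
    _ = _ := by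
        refine Finset.sum_congr rfl fun j _ => ?_
        conv_rhs => rw [← ha.expand_star _ (hb.mem j)]
        simp [Finset.mul_sum]

lemma HSFrame.phi_comm {S : Set (Matrix (Fin n) (Fin n) ℂ)}
    {a : ι → Matrix (Fin n) (Fin n) ℂ} (ha : HSFrame S a) (X C : Matrix (Fin n) (Fin n) ℂ)
    (h1 : ∀ Y ∈ S, C * Y ∈ S) (h2 : ∀ Y ∈ S, Cᴴ * Y ∈ S) :
    C * hsPhi a X = hsPhi a X * C := by
  unfold hsPhi
  rw [Finset.mul_sum, Finset.sum_mul]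
  calc ∑ i, C * (a i * X * (a i)ᴴ)
      = ∑ i, ∑ j, ((a j)ᴴ * (C * a i)).trace • (a j * X * (a i)ᴴ) := by
        refine Finset.sum_congr rfl fun i _ => ?_
        rw [← Matrix.mul_assoc, ← Matrix.mul_assoc]
        conv_lhs => enter [1, 1]; rw [← ha.expand _ (h1 _ (ha.mem i))]
        simp [Finset.sum_mul]
    _ = ∑ j, ∑ i, ((a j)ᴴ * (C * a i)).trace • (a j * X * (a i)ᴴ) := Finset.sum_comm
    _ = _ := by
        refine Finset.sum_congr rfl fun j _ => ?_
        have := ha.expand_star _ (h2 _ (ha.mem j))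
        rw [conjTranspose_mul, conjTranspose_conjTranspose] at this
        rw [Matrix.mul_assoc _ _ C, ← this]
        simp [Finset.mul_sum, Matrix.mul_assoc]

lemma HSFrame.star {S : Set (Matrix (Fin n) (Fin n) ℂ)}
    {a : ι → Matrix (Fin n) (Fin n) ℂ} (ha : HSFrame S a) (hS : ∀ Y ∈ S, Yᴴ ∈ S) :
    HSFrame S (fun i => (a i)ᴴ) where
  mem i := hS _ (ha.mem i)
  expand X hX := by
    have := ha.expand_star _ (hS X hX)
    rw [conjTranspose_conjTranspose] at this
    simpa [trace_mul_comm X] using this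

lemma hsPhi_of_comm {a : ι → Matrix (Fin n) (Fin n) ℂ} {Y : Matrix (Fin n) (Fin n) ℂ}
    (h : ∀ i, a i * Y = Y * a i) : hsPhi a Y = Y * hsPhi a 1 := by
  simp [hsPhi, Finset.mul_sum, h, Matrix.mul_assoc]

lemma HSFrame.trace_mul_phi {S : Set (Matrix (Fin n) (Fin n) ℂ)}
    {a : ι → Matrix (Fin n) (Fin n) ℂ} (ha : HSFrame S a) (hS : ∀ Y ∈ S, Yᴴ ∈ S)
    (X Y : Matrix (Fin n) (Fin n) ℂ) :
    (X * hsPhi a Y).trace = (hsPhi a X * Y).trace := by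
  rw [ha.phi_eq (ha.star hS) X]
  simp only [hsPhi, Finset.mul_sum, Finset.sum_mul, trace_sum, conjTranspose_conjTranspose]
  refine Finset.sum_congr rfl fun i _ => ?_
  rw [← Matrix.mul_assoc, trace_mul_comm]
  simp [Matrix.mul_assoc]

lemma exists_hsFrame (S : Submodule ℂ (Matrix (Fin n) (Fin n) ℂ)) :
    ∃ (d : ℕ) (a : Fin d → Matrix (Fin n) (Fin n) ℂ), HSFrame (S : Set _) a ∧
      ∀ i j, ((a i)ᴴ * a j).trace = if i = j then 1 else 0 := by
  classical
  let e : Matrix (Fin n) (Fin n) ℂ ≃ₗ[ℂ] EuclideanSpace ℂ (Fin n × Fin n) :=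
    (LinearEquiv.curry ℂ ℂ (Fin n) (Fin n)).symm.trans
      (WithLp.linearEquiv 2 ℂ (Fin n × Fin n → ℂ)).symm
  have he : ∀ X Y, inner ℂ (e X) (e Y) = (Xᴴ * Y).trace := by
    intro X Y
    have h1 : ∀ (X : Matrix (Fin n) (Fin n) ℂ) p, (e X) p = X p.1 p.2 := fun X p => rfl
    rw [PiLp.inner_apply, Fintype.sum_prod_type, Finset.sum_comm]
    simp [h1, trace, Matrix.mul_apply, mul_comm]
  let T := S.map e.toLinearMap
  let b := stdOrthonormalBasis ℂ T
  refine ⟨_, fun i => e.symm (b i : EuclideanSpace ℂ (Fin n × Fin n)), ⟨?_, ?_⟩, ?_⟩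
  · intro i
    obtain ⟨x, hx, hx'⟩ := (b i).2
    rw [← hx']
    simpa using hx
  · intro X hX
    have hXT : e X ∈ T := ⟨X, hX, rfl⟩
    have := congrArg (fun t : T => e.symm (t : EuclideanSpace ℂ (Fin n × Fin n)))
      (b.sum_repr' ⟨e X, hXT⟩)
    simp only [Submodule.coe_sum, Submodule.coe_smul, map_sum, map_smul,
      LinearEquiv.symm_apply_apply, Submodule.coe_inner] at this
    conv_rhs => rw [← this]
    refine Finset.sum_congr rfl fun i _ => ?_
    rw [← he, LinearEquiv.apply_symm_apply]
  · intro i j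
    rw [← he, LinearEquiv.apply_symm_apply, LinearEquiv.apply_symm_apply, ← Submodule.coe_inner]
    exact orthonormal_iff_ite.mp b.orthonormal i j

lemma hsFrame_single : HSFrame (Set.univ : Set (Matrix (Fin n) (Fin n) ℂ))
    (fun p : Fin n × Fin n => Matrix.single p.1 p.2 (1 : ℂ)) where
  mem _ := trivial
  expand X _ := by
    conv_rhs => rw [matrix_eq_sum_single X]
    rw [Fintype.sum_prod_type]
    refine Finset.sum_congr rfl fun i _ => Finset.sum_congr rfl fun j _ => ?_
    simp [trace_single_mul]

lemma hsPhi_single (X : Matrix (Fin n) (Fin n) ℂ) :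
    hsPhi (fun p : Fin n × Fin n => Matrix.single p.1 p.2 (1 : ℂ)) X = X.trace • 1 := by
  unfold hsPhi
  rw [Fintype.sum_prod_type]
  ext i j
  simp only [conjTranspose_single, Matrix.single_mul_mul_single, star_one, one_mul, mul_one,
    Matrix.sum_apply, Matrix.single_apply, Matrix.smul_apply, Matrix.one_apply, trace, diag]
  by_cases h : i = j
  · subst h; simp
  · simp [h]
    refine Finset.sum_eq_zero fun x _ => ?_
    grind

lemma sum_sandwich (M N : Matrix (Fin n) (Fin n) ℂ) :
    ∑ k : Fin n, ∑ l : Fin n, (M * Matrix.single k l (1 : ℂ) * N : Matrix (Fin n) (Fin n) ℂ) k l = M.trace * N.trace := by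
  simp [trace, Finset.sum_mul_sum, Matrix.mul_apply, Matrix.single_apply, ite_and]

lemma sum_trace_single (M N : Matrix (Fin n) (Fin n) ℂ) :
    ∑ k, ∑ l, (M * Matrix.single k l (1 : ℂ)).trace * N k l = (N * M).trace := by
  simp only [trace_mul_single]
  simp [trace, Matrix.mul_apply, mul_comm]

lemma hsPhi_one_isUnit {S : Set (Matrix (Fin n) (Fin n) ℂ)}
    {a : ι → Matrix (Fin n) (Fin n) ℂ} (ha : HSFrame S a) (h1 : 1 ∈ S) :
    IsUnit (hsPhi a 1) := by
  rw [← Matrix.mulVec_injective_iff_isUnit]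
  refine (injective_iff_map_eq_zero (Matrix.mulVecLin (hsPhi a 1))).2 fun v hv => ?_
  have hv' : (hsPhi a 1) *ᵥ v = 0 := hv
  have hs : ∑ i, star ((a i)ᴴ *ᵥ v) ⬝ᵥ ((a i)ᴴ *ᵥ v) = 0 := by
    have : star v ⬝ᵥ ((hsPhi a 1) *ᵥ v) = 0 := by rw [hv']; simp
    rw [← this]
    simp only [hsPhi, Matrix.sum_mulVec, dotProduct_sum]
    refine Finset.sum_congr rfl fun i _ => ?_
    rw [star_mulVec, conjTranspose_conjTranspose, ← dotProduct_mulVec, mulVec_mulVec, mul_one]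
  open scoped ComplexOrder in
  have h0 : ∀ i, (a i)ᴴ *ᵥ v = 0 := by
    intro i
    have := (Finset.sum_eq_zero_iff_of_nonneg
      (fun i _ => dotProduct_star_self_nonneg ((a i)ᴴ *ᵥ v))).1 hs i (Finset.mem_univ i)
    exact dotProduct_star_self_eq_zero.1 this
  have := congrArg (fun M => M *ᵥ v) (ha.expand_star 1 h1)
  simpa [Matrix.sum_mulVec, Matrix.smul_mulVec, h0] using this.symm

lemma mem_matCommutant_star {𝒜 : StarSubalgebra ℂ (Matrix (Fin n) (Fin n) ℂ)}
    {X : Matrix (Fin n) (Fin n) ℂ} (hX : X ∈ matCommutant (𝒜 : Set (Matrix (Fin n) (Fin n) ℂ))) :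
    Xᴴ ∈ matCommutant (𝒜 : Set (Matrix (Fin n) (Fin n) ℂ)) := by
  intro A hA
  have := congrArg conjTranspose (hX Aᴴ (star_mem (s := 𝒜) hA))
  simpa using this.symm

lemma HSFrame.phi_mem_commutant {𝒜 : StarSubalgebra ℂ (Matrix (Fin n) (Fin n) ℂ)}
    {a : ι → Matrix (Fin n) (Fin n) ℂ} (ha : HSFrame (𝒜 : Set (Matrix (Fin n) (Fin n) ℂ)) a)
    (X : Matrix (Fin n) (Fin n) ℂ) :
    hsPhi a X ∈ matCommutant (𝒜 : Set (Matrix (Fin n) (Fin n) ℂ)) := by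
  intro A hA
  exact ha.phi_comm X A (fun Y hY => mul_mem (S := StarSubalgebra ℂ _) hA hY)
    (fun Y hY => mul_mem (S := StarSubalgebra ℂ _) (star_mem (s := 𝒜) hA) hY)

lemma HSFrame.phi_one_mem {𝒜 : StarSubalgebra ℂ (Matrix (Fin n) (Fin n) ℂ)}
    {a : ι → Matrix (Fin n) (Fin n) ℂ} (ha : HSFrame (𝒜 : Set (Matrix (Fin n) (Fin n) ℂ)) a) :
    hsPhi a 1 ∈ 𝒜 := by
  refine sum_mem fun i _ => ?_
  rw [mul_one]
  exact mul_mem (S := StarSubalgebra ℂ _) (ha.mem i) (star_mem (s := 𝒜) (ha.mem i))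

lemma hsPhi_one_herm (a : ι → Matrix (Fin n) (Fin n) ℂ) : (hsPhi a 1)ᴴ = hsPhi a 1 := by
  simp [hsPhi, conjTranspose_sum]

lemma hsPhi_comp (a : ι → Matrix (Fin n) (Fin n) ℂ) (b : κ → Matrix (Fin n) (Fin n) ℂ)
    (X : Matrix (Fin n) (Fin n) ℂ) :
    hsPhi a (hsPhi b X) = hsPhi (fun p : ι × κ => a p.1 * b p.2) X := by
  simp [hsPhi, Fintype.sum_prod_type, Finset.mul_sum, Finset.sum_mul, Matrix.mul_assoc]

/-- If the commutants are complementary, then the map of the first algebra collapses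
the second commutant. -/
lemma phi_on_commutant {𝒜 ℬ : StarSubalgebra ℂ (Matrix (Fin n) (Fin n) ℂ)}
    {a : ι → Matrix (Fin n) (Fin n) ℂ} (ha : HSFrame (𝒜 : Set (Matrix (Fin n) (Fin n) ℂ)) a)
    (hc : Complementary (matCommutant (𝒜 : Set (Matrix (Fin n) (Fin n) ℂ)))
        (matCommutant (ℬ : Set (Matrix (Fin n) (Fin n) ℂ))))
    {Y : Matrix (Fin n) (Fin n) ℂ} (hY : Y ∈ matCommutant (ℬ : Set (Matrix (Fin n) (Fin n) ℂ))) :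
    hsPhi a Y = (Y.trace / n) • hsPhi a 1 := by
  have hz := ha.phi_mem_commutant 1
  have hstar : ∀ Y ∈ (𝒜 : Set (Matrix (Fin n) (Fin n) ℂ)), Yᴴ ∈ (𝒜 : Set _) :=
    fun Y hY => star_mem (s := 𝒜) hY
  have hmul : ∀ X ∈ matCommutant (𝒜 : Set (Matrix (Fin n) (Fin n) ℂ)),
      hsPhi a 1 * X ∈ matCommutant (𝒜 : Set (Matrix (Fin n) (Fin n) ℂ)) := by
    intro X hX A hA
    rw [← Matrix.mul_assoc, hz A hA, Matrix.mul_assoc, hX A hA, Matrix.mul_assoc]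
  have key : ∀ X ∈ matCommutant (𝒜 : Set (Matrix (Fin n) (Fin n) ℂ)),
      (Xᴴ * (hsPhi a Y - (Y.trace / n) • hsPhi a 1)).trace = 0 := by
    intro X hX
    have h1 : (Xᴴ * hsPhi a Y).trace = (Xᴴ * hsPhi a 1 * Y).trace := by
      rw [ha.trace_mul_phi hstar,
        hsPhi_of_comm (fun i => mem_matCommutant_star hX _ (ha.mem i))]
    have h2 := hc _ (hmul X hX) Y hY
    rw [conjTranspose_mul, hsPhi_one_herm] at h2
    rw [Matrix.mul_sub, trace_sub, h1, h2, Matrix.mul_smul, trace_smul, smul_eq_mul,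
      Fintype.card_fin]
    ring
  have hD : hsPhi a Y - (Y.trace / n) • hsPhi a 1 ∈
      matCommutant (𝒜 : Set (Matrix (Fin n) (Fin n) ℂ)) := by
    intro A hA
    rw [Matrix.mul_sub, Matrix.sub_mul, ha.phi_mem_commutant Y A hA, Matrix.mul_smul,
      Matrix.smul_mul, hz A hA]
  have := key _ hD
  open scoped ComplexOrder in
  rw [trace_conjTranspose_mul_self_eq_zero_iff] at this
  exact sub_eq_zero.1 this

/-- If the double map is the normalized trace, the first map is scalar on the commutant. -/
lemma phi_scalar {ℬ : StarSubalgebra ℂ (Matrix (Fin n) (Fin n) ℂ)}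
    {a : ι → Matrix (Fin n) (Fin n) ℂ}
    {b : κ → Matrix (Fin n) (Fin n) ℂ} (hb : HSFrame (ℬ : Set (Matrix (Fin n) (Fin n) ℂ)) b)
    (h : ∀ X, hsPhi a (hsPhi b X) = (X.trace / n) • 1)
    {Y : Matrix (Fin n) (Fin n) ℂ} (hY : Y ∈ matCommutant (ℬ : Set (Matrix (Fin n) (Fin n) ℂ))) :
    hsPhi a Y = ((Y * (hsPhi b 1)⁻¹).trace / n) • 1 := by
  have hu := hsPhi_one_isUnit hb (one_mem ℬ)
  have hd := (Matrix.isUnit_iff_isUnit_det _).1 hu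
  rw [← h]
  congr 1
  have hz := hb.phi_mem_commutant 1
  have hi : ∀ B ∈ ℬ, B * (hsPhi b 1)⁻¹ = (hsPhi b 1)⁻¹ * B := by
    intro B hB
    have hcm : Commute B (hsPhi b 1) := hz B hB
    calc B * (hsPhi b 1)⁻¹ = (hsPhi b 1)⁻¹ * (hsPhi b 1 * B) * (hsPhi b 1)⁻¹ := by
          rw [← Matrix.mul_assoc, Matrix.nonsing_inv_mul _ hd, Matrix.one_mul]
      _ = (hsPhi b 1)⁻¹ * B := by
          rw [← hcm.eq, Matrix.mul_assoc, Matrix.mul_assoc, Matrix.mul_nonsing_inv _ hd,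
            Matrix.mul_one]
  rw [hsPhi_of_comm, Matrix.mul_assoc, Matrix.nonsing_inv_mul _ hd, Matrix.mul_one]
  intro i
  rw [← Matrix.mul_assoc, hY _ (hb.mem i), Matrix.mul_assoc, hi _ (hb.mem i), Matrix.mul_assoc]

lemma Complementary.trace_mul {𝒜 ℬ : StarSubalgebra ℂ (Matrix (Fin n) (Fin n) ℂ)}
    (hc : Complementary (𝒜 : Set (Matrix (Fin n) (Fin n) ℂ))
      (ℬ : Set (Matrix (Fin n) (Fin n) ℂ)))
    {A B : Matrix (Fin n) (Fin n) ℂ} (hA : A ∈ 𝒜) (hB : B ∈ ℬ) :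
    (A * B).trace = A.trace * B.trace / n := by
  have := hc Aᴴ (star_mem (s := 𝒜) hA) B hB
  simpa using this

lemma trace_prod {𝒜 ℬ : StarSubalgebra ℂ (Matrix (Fin n) (Fin n) ℂ)}
    (hc : Complementary (𝒜 : Set (Matrix (Fin n) (Fin n) ℂ))
      (ℬ : Set (Matrix (Fin n) (Fin n) ℂ)))
    {A B A' B' : Matrix (Fin n) (Fin n) ℂ} (hA : A ∈ 𝒜) (hB : B ∈ ℬ)
    (hA' : A' ∈ 𝒜) (hB' : B' ∈ ℬ) :
    ((A * B)ᴴ * (A' * B')).trace = (Aᴴ * A').trace * (Bᴴ * B').trace / n := by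
  have h := hc.trace_mul (mul_mem (star_mem hA) hA') (mul_mem hB' (star_mem hB))
  simp only [star_eq_conjTranspose] at h
  rw [trace_mul_comm Bᴴ, ← h, conjTranspose_mul, Matrix.mul_assoc, trace_mul_comm]
  simp only [Matrix.mul_assoc]

/-- If products span, the double map is the normalized trace. -/
lemma double_phi (hn : n ≠ 0) {𝒜 ℬ : StarSubalgebra ℂ (Matrix (Fin n) (Fin n) ℂ)}
    (hc : Complementary (𝒜 : Set (Matrix (Fin n) (Fin n) ℂ))
      (ℬ : Set (Matrix (Fin n) (Fin n) ℂ)))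
    {a : ι → Matrix (Fin n) (Fin n) ℂ} (ha : HSFrame (𝒜 : Set (Matrix (Fin n) (Fin n) ℂ)) a)
    {b : κ → Matrix (Fin n) (Fin n) ℂ} (hb : HSFrame (ℬ : Set (Matrix (Fin n) (Fin n) ℂ)) b)
    (hs : Submodule.span ℂ {X : Matrix (Fin n) (Fin n) ℂ | ∃ A ∈ 𝒜, ∃ B ∈ ℬ, X = A * B} = ⊤)
    (X : Matrix (Fin n) (Fin n) ℂ) :
    hsPhi a (hsPhi b X) = (X.trace / n) • 1 := by
  have hn' : (n : ℂ) ≠ 0 := by exact_mod_cast hn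
  have hsq : ((Real.sqrt n : ℝ) : ℂ) * ((Real.sqrt n : ℝ) : ℂ) = n := by
    rw [← Complex.ofReal_mul, Real.mul_self_sqrt (Nat.cast_nonneg n), Complex.ofReal_natCast]
  have hfr : HSFrame (Set.univ : Set (Matrix (Fin n) (Fin n) ℂ))
      (fun p : ι × κ => ((Real.sqrt n : ℝ) : ℂ) • (a p.1 * b p.2)) := by
    refine ⟨fun _ => trivial, fun X _ => ?_⟩
    have hX : X ∈ Submodule.span ℂ
      {X : Matrix (Fin n) (Fin n) ℂ | ∃ A ∈ 𝒜, ∃ B ∈ ℬ, X = A * B} := by rw [hs]; trivial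
    induction hX using Submodule.span_induction with
    | mem X hX =>
      obtain ⟨A, hA, B, hB, rfl⟩ := hX
      conv_rhs => rw [← ha.expand A hA, ← hb.expand B hB, Finset.sum_mul_sum]
      rw [Fintype.sum_prod_type]
      refine Finset.sum_congr rfl fun i _ => Finset.sum_congr rfl fun j _ => ?_
      rw [conjTranspose_smul, Matrix.smul_mul, trace_smul,
        trace_prod hc (ha.mem i) (hb.mem j) hA hB, smul_smul, Matrix.smul_mul, Matrix.mul_smul,
        smul_smul]
      congr 1
      simp only [smul_eq_mul, Complex.star_def, Complex.conj_ofReal]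
      field_simp
      linear_combination (((a i)ᴴ * A).trace * ((b j)ᴴ * B).trace) * hsq
    | zero => simp
    | add X Y _ _ hX hY =>
      simp only [Matrix.mul_add, trace_add, add_smul, Finset.sum_add_distrib, hX trivial,
        hY trivial]
    | smul c X _ hX =>
      conv_rhs => rw [← hX trivial]
      rw [Finset.smul_sum]
      refine Finset.sum_congr rfl fun p _ => ?_
      rw [Matrix.mul_smul, trace_smul, smul_eq_mul, mul_smul]
  have h := (hfr.phi_eq hsFrame_single X).trans (hsPhi_single X)
  have h2 : hsPhi (fun p : ι × κ => ((Real.sqrt n : ℝ) : ℂ) • (a p.1 * b p.2)) X =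
      (n : ℂ) • hsPhi (fun p : ι × κ => a p.1 * b p.2) X := by
    simp only [hsPhi, Finset.smul_sum]
    refine Finset.sum_congr rfl fun p _ => ?_
    rw [conjTranspose_smul, Matrix.smul_mul, Matrix.smul_mul, Matrix.mul_smul, smul_smul,
      Complex.star_def, Complex.conj_ofReal, hsq]
  rw [h2, ← hsPhi_comp] at h
  rw [div_eq_inv_mul, mul_smul, ← h, smul_smul, inv_mul_cancel₀ hn', one_smul]

/-- A frame that contains the identity in its span has the right total trace. -/
lemma HSFrame.sum_trace {S : Set (Matrix (Fin n) (Fin n) ℂ)}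
    {a : ι → Matrix (Fin n) (Fin n) ℂ} (ha : HSFrame S a) (h1 : 1 ∈ S) :
    ∑ i, (a i)ᴴ.trace * (a i).trace = n := by
  have := congrArg trace (ha.expand 1 h1)
  simpa [trace_sum, trace_smul] using this

end

/-- For complementary subalgebras 𝒜₁, 𝒜₂ of M_n(ℂ), the commutants 𝒜₁′, 𝒜₂′ are
complementary iff the products 𝒜₁𝒜₂ linearly span M_n(ℂ). -/
theorem commutants_complementary_iff_products_span (n : ℕ)
    (𝒜₁ 𝒜₂ : StarSubalgebra ℂ (Matrix (Fin n) (Fin n) ℂ))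
    (hc : Complementary (𝒜₁ : Set (Matrix (Fin n) (Fin n) ℂ)) (𝒜₂ : Set (Matrix (Fin n) (Fin n) ℂ))) :
    Complementary (matCommutant (𝒜₁ : Set (Matrix (Fin n) (Fin n) ℂ)))
        (matCommutant (𝒜₂ : Set (Matrix (Fin n) (Fin n) ℂ))) ↔
      Submodule.span ℂ {X : Matrix (Fin n) (Fin n) ℂ | ∃ A ∈ 𝒜₁, ∃ B ∈ 𝒜₂, X = A * B} = ⊤ := by
  classical
  rcases Nat.eq_zero_or_pos n with rfl | hpos
  · refine ⟨fun _ => ?_, fun _ A _ B _ => ?_⟩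
    · exact Subsingleton.elim _ _
    · simp [trace]
  have hn : n ≠ 0 := hpos.ne'
  have hn' : (n : ℂ) ≠ 0 := by exact_mod_cast hn
  obtain ⟨d₁, a, ha, hao⟩ := exists_hsFrame (Subalgebra.toSubmodule 𝒜₁.toSubalgebra)
  obtain ⟨d₂, b, hb, hbo⟩ := exists_hsFrame (Subalgebra.toSubmodule 𝒜₂.toSubalgebra)
  replace ha : HSFrame (𝒜₁ : Set (Matrix (Fin n) (Fin n) ℂ)) a := ha
  replace hb : HSFrame (𝒜₂ : Set (Matrix (Fin n) (Fin n) ℂ)) b := hb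
  have hst₁ : ∀ Y ∈ (𝒜₁ : Set (Matrix (Fin n) (Fin n) ℂ)), Yᴴ ∈ (𝒜₁ : Set _) :=
    fun Y hY => star_mem (s := 𝒜₁) hY
  have hst₂ : ∀ Y ∈ (𝒜₂ : Set (Matrix (Fin n) (Fin n) ℂ)), Yᴴ ∈ (𝒜₂ : Set _) :=
    fun Y hY => star_mem (s := 𝒜₂) hY
  have htr₁ : (hsPhi a 1).trace = d₁ := by
    simp only [hsPhi, trace_sum, mul_one]
    rw [Finset.sum_congr rfl (fun i _ => by rw [trace_mul_comm, hao i i, if_pos rfl])]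
    simp
  have htr₂ : (hsPhi b 1).trace = d₂ := by
    simp only [hsPhi, trace_sum, mul_one]
    rw [Finset.sum_congr rfl (fun i _ => by rw [trace_mul_comm, hbo i i, if_pos rfl])]
    simp
  constructor
  · intro hcc
    have hform : ∀ X, hsPhi (fun p : Fin d₁ × Fin d₂ => a p.1 * b p.2) X =
        ((hsPhi b 1 * X).trace / n) • hsPhi a 1 := by
      intro X
      rw [← hsPhi_comp, phi_on_commutant ha hcc (hb.phi_mem_commutant X)]
      have := hb.trace_mul_phi hst₂ 1 X
      rw [Matrix.one_mul] at this
      rw [this]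
    have hL : ∑ k : Fin n, ∑ l : Fin n, hsPhi (fun p : Fin d₁ × Fin d₂ => a p.1 * b p.2)
        (Matrix.single k l (1 : ℂ)) k l = 1 := by
      simp only [hsPhi, Matrix.sum_apply]
      rw [Finset.sum_congr rfl (fun k _ => Finset.sum_comm), Finset.sum_comm]
      rw [Finset.sum_congr rfl (fun p _ => sum_sandwich _ _)]
      have h1 : ∀ p : Fin d₁ × Fin d₂, (a p.1 * b p.2).trace * (a p.1 * b p.2)ᴴ.trace =
          (((a p.1)ᴴ.trace * (a p.1).trace) * ((b p.2)ᴴ.trace * (b p.2).trace)) / (n ^ 2 : ℂ) := by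
        intro p
        rw [conjTranspose_mul, trace_mul_comm (b p.2)ᴴ, hc.trace_mul (ha.mem _) (hb.mem _),
          hc.trace_mul (hst₁ _ (ha.mem _)) (hst₂ _ (hb.mem _))]
        ring
      rw [Finset.sum_congr rfl (fun p _ => h1 p), ← Finset.sum_div, Fintype.sum_prod_type]
      dsimp only
      rw [← Finset.sum_mul_sum, ha.sum_trace (one_mem 𝒜₁), hb.sum_trace (one_mem 𝒜₂)]
      field_simp
    have hR : ∑ k : Fin n, ∑ l : Fin n, hsPhi (fun p : Fin d₁ × Fin d₂ => a p.1 * b p.2)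
        (Matrix.single k l (1 : ℂ)) k l = (d₁ * d₂ : ℂ) / n / n := by
      simp only [hform, Matrix.smul_apply, smul_eq_mul, div_mul_eq_mul_div]
      simp only [← Finset.sum_div]
      rw [sum_trace_single, hc.trace_mul ha.phi_one_mem hb.phi_one_mem, htr₁, htr₂]
    have hd : d₁ * d₂ = n * n := by
      have h := hR.symm.trans hL
      rw [div_div, div_eq_one_iff_eq (mul_ne_zero hn' hn')] at h
      exact_mod_cast h
    have hli : LinearIndependent ℂ (fun p : Fin d₁ × Fin d₂ => a p.1 * b p.2) := by
      rw [Fintype.linearIndependent_iff]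
      intro g hg p
      have h := congrArg (fun M => ((a p.1 * b p.2)ᴴ * M).trace) hg
      have h2 : ∀ q : Fin d₁ × Fin d₂, ((a p.1 * b p.2)ᴴ * (g q • (a q.1 * b q.2))).trace =
          if p = q then g q / n else 0 := by
        intro q
        rw [Matrix.mul_smul, trace_smul, trace_prod hc (ha.mem _) (hb.mem _) (ha.mem _) (hb.mem _),
          hao, hbo]
        by_cases h1 : p.1 = q.1 <;> by_cases h2 : p.2 = q.2 <;>
          simp [h1, h2, Prod.ext_iff, div_eq_mul_inv]
      simp only [Finset.mul_sum, trace_sum, h2, Finset.sum_ite_eq, Finset.mem_univ, if_true,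
        Matrix.mul_zero, trace_zero] at h
      exact (div_eq_zero_iff.1 h).resolve_right hn'
    have htop := hli.span_eq_top_of_card_eq_finrank' (by
      simp [Module.finrank_matrix, hd])
    rw [eq_top_iff, ← htop]
    refine Submodule.span_mono ?_
    rintro _ ⟨p, rfl⟩
    exact ⟨_, ha.mem _, _, hb.mem _, rfl⟩
  · intro hs
    have hs' : Submodule.span ℂ
        {X : Matrix (Fin n) (Fin n) ℂ | ∃ A ∈ 𝒜₂, ∃ B ∈ 𝒜₁, X = A * B} = ⊤ := by
      rw [eq_top_iff]
      intro X _
      have hX : Xᴴ ∈ Submodule.span ℂ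
        {X : Matrix (Fin n) (Fin n) ℂ | ∃ A ∈ 𝒜₁, ∃ B ∈ 𝒜₂, X = A * B} := by rw [hs]; trivial
      rw [← conjTranspose_conjTranspose X]
      generalize Xᴴ = Z at hX
      induction hX using Submodule.span_induction with
      | mem X hX =>
        obtain ⟨A, hA, B, hB, rfl⟩ := hX
        exact Submodule.subset_span ⟨_, hst₂ _ hB, _, hst₁ _ hA, conjTranspose_mul _ _⟩
      | zero => simp
      | add X Y _ _ hX hY => rw [conjTranspose_add]; exact add_mem hX hY
      | smul c X _ hX => rw [conjTranspose_smul]; exact Submodule.smul_mem _ _ hX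
    have hc' : Complementary (𝒜₂ : Set (Matrix (Fin n) (Fin n) ℂ))
        (𝒜₁ : Set (Matrix (Fin n) (Fin n) ℂ)) := by
      intro B hB A hA
      rw [trace_mul_comm, hc.trace_mul hA (hst₂ _ hB), Fintype.card_fin, mul_comm A.trace]
    have hone : ∀ S : Set (Matrix (Fin n) (Fin n) ℂ), (1 : Matrix (Fin n) (Fin n) ℂ) ∈
      matCommutant S := fun S A _ => by simp
    have k1 := fun Y hY => phi_scalar (Y := Y) hb (double_phi hn hc ha hb hs) hY
    have k2 := fun Y hY => phi_scalar (Y := Y) ha (double_phi hn hc' hb ha hs') hY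
    obtain ⟨α, hα⟩ : ∃ α : ℂ, hsPhi a 1 = α • 1 := ⟨_, k1 1 (hone _)⟩
    obtain ⟨β, hβ⟩ : ∃ β : ℂ, hsPhi b 1 = β • 1 := ⟨_, k2 1 (hone _)⟩
    haveI : Nonempty (Fin n) := ⟨⟨0, hpos⟩⟩
    have hα0 : α ≠ 0 := by
      rintro rfl
      have := hsPhi_one_isUnit ha (one_mem 𝒜₁)
      rw [hα, zero_smul] at this
      exact not_isUnit_zero this
    -- the map of the first algebra is a multiple of the trace on the second commutant
    obtain ⟨γ, hγ⟩ : ∃ γ : ℂ, ∀ Y ∈ matCommutant (𝒜₂ : Set (Matrix (Fin n) (Fin n) ℂ)),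
        hsPhi a Y = (γ * Y.trace) • 1 := by
      have hinv : ∃ δ : ℂ, (hsPhi b 1)⁻¹ = δ • 1 := by
        have hβ0 : β ≠ 0 := by
          rintro rfl
          have := hsPhi_one_isUnit hb (one_mem 𝒜₂)
          rw [hβ, zero_smul] at this
          exact not_isUnit_zero this
        refine ⟨β⁻¹, Matrix.inv_eq_left_inv ?_⟩
        rw [hβ, Matrix.smul_mul, Matrix.one_mul, smul_smul, inv_mul_cancel₀ hβ0, one_smul]
      obtain ⟨δ, hδ⟩ := hinv
      refine ⟨δ / n, fun Y hY => ?_⟩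
      rw [k1 Y hY, hδ, Matrix.mul_smul, Matrix.mul_one, trace_smul, smul_eq_mul]
      congr 1
      ring
    have hγα : γ * n = α := by
      have h := (hγ 1 (hone _)).symm.trans hα
      have h' := congrFun (congrFun h ⟨0, hpos⟩) ⟨0, hpos⟩
      simpa using h'
    intro X hX Y hY
    have e1 : (Xᴴ * hsPhi a Y).trace = α * (Xᴴ * Y).trace := by
      rw [ha.trace_mul_phi hst₁,
        hsPhi_of_comm (fun i => mem_matCommutant_star hX _ (ha.mem i)), hα]
      simp
    rw [hγ Y hY, Matrix.mul_smul, Matrix.mul_one, trace_smul, smul_eq_mul] at e1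
    rw [Fintype.card_fin, eq_div_iff hn']
    apply mul_left_cancel₀ hα0
    rw [← mul_assoc, ← e1, ← hγα]
    ring
end

section
/- If 𝒜_1 and 𝒜_2 are complementary subalgebras of M_n(ℂ) ⊗ M_n(ℂ), each either isomorphic to M_n (an F-subalgebra) or maximal abelian (hence of dimension n² in both cases), then their commutants 𝒜_1′ and 𝒜_2′ in M_n ⊗ M_n are also complementary. -/
open Matrix

/-- A normalized orthonormal frame inside a star subalgebra. -/
def HasGoodFrame {ι : Type*} [Fintype ι] [DecidableEq ι]
    (S : Set (Matrix ι ι ℂ)) : Prop :=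
  ∃ a : ι → Matrix ι ι ℂ, (∀ i, a i ∈ S) ∧
    (∀ i j, ((a i)ᴴ * a j).trace = if i = j then 1 else 0) ∧
    (∑ i, (a i)ᴴ * a i = 1) ∧ (∑ i, a i * (a i)ᴴ = 1)

/-- An orthonormal family of full cardinality is complete. -/
lemma complete_of_orthonormal {ι κ : Type*} [Fintype ι] [DecidableEq ι] [Fintype κ] [DecidableEq κ]
    (hcard : Fintype.card κ = Fintype.card (ι × ι)) (c : ℂ)
    (u : κ → Matrix ι ι ℂ)
    (hu : ∀ k l, c * ((u k)ᴴ * u l).trace = if k = l then 1 else 0) (Y : Matrix ι ι ℂ) :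
    c • ∑ k, u k * Y * (u k)ᴴ = Y.trace • (1 : Matrix ι ι ℂ) := by
  let U : Matrix κ (ι × ι) ℂ := fun k p => c * star (u k p.1 p.2)
  let W : Matrix (ι × ι) κ ℂ := fun p k => u k p.1 p.2
  have h1 : U * W = 1 := by
    ext k l
    rw [Matrix.one_apply, ← hu k l, Matrix.mul_apply, Matrix.trace, Fintype.sum_prod_type,
      Finset.sum_comm]
    simp only [U, W, Matrix.diag_apply, Matrix.mul_apply, Matrix.conjTranspose_apply,
      Finset.mul_sum, mul_assoc]
  have h2 : W * U = 1 := (Matrix.mul_eq_one_comm_of_card_eq _ _ _ hcard).1 h1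
  have h3 : ∀ p q r s, c * ∑ k, u k p q * star (u k r s) =
      if (p, q) = (r, s) then 1 else 0 := by
    intro p q r s
    have := congrFun (congrFun h2 (p, q)) (r, s)
    rw [Matrix.one_apply, Matrix.mul_apply] at this
    rw [← this, Finset.mul_sum]
    refine Finset.sum_congr rfl fun k _ => ?_
    simp only [U, W]; ring
  ext p r
  have : (c • ∑ k, u k * Y * (u k)ᴴ) p r
      = ∑ s, ∑ q, Y q s * (c * ∑ k, u k p q * star (u k r s)) := by
    simp only [Matrix.smul_apply, Matrix.sum_apply, Matrix.mul_apply, Matrix.conjTranspose_apply,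
      Finset.sum_mul, Finset.mul_sum, smul_eq_mul]
    rw [Finset.sum_comm]
    refine Finset.sum_congr rfl fun s _ => ?_
    rw [Finset.sum_comm]
    refine Finset.sum_congr rfl fun q _ => ?_
    refine Finset.sum_congr rfl fun k _ => ?_
    ring
  rw [this]
  simp only [h3, Prod.mk.injEq, Matrix.smul_apply, Matrix.one_apply, Matrix.trace,
    Matrix.diag_apply, smul_eq_mul]
  by_cases hpr : p = r <;> simp [hpr]

lemma commutants_of_frames {ι : Type*} [Fintype ι] [DecidableEq ι] [Nonempty ι]
    (S T : StarSubalgebra ℂ (Matrix ι ι ℂ))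
    (hS : HasGoodFrame (S : Set (Matrix ι ι ℂ))) (hT : HasGoodFrame (T : Set (Matrix ι ι ℂ)))
    (hc : Complementary (S : Set (Matrix ι ι ℂ)) (T : Set (Matrix ι ι ℂ))) :
    Complementary (matCommutant (S : Set (Matrix ι ι ℂ)))
      (matCommutant (T : Set (Matrix ι ι ℂ))) := by
  obtain ⟨a, haS, hao, ha1, -⟩ := hS
  obtain ⟨b, hbT, hbo, -, hb2⟩ := hT
  have hN : (Fintype.card ι : ℂ) ≠ 0 := by simp
  intro X hX Y hY
  have key := complete_of_orthonormal (ι := ι) (κ := ι × ι) rfl (Fintype.card ι : ℂ)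
    (fun k => a k.1 * b k.2) (by
      rintro ⟨i, j⟩ ⟨k, l⟩
      have e1 : ((a i * b j)ᴴ * (a k * b l)).trace = (((a k)ᴴ * a i)ᴴ * (b l * (b j)ᴴ)).trace := by
        rw [Matrix.conjTranspose_mul, Matrix.conjTranspose_mul, Matrix.conjTranspose_conjTranspose,
          Matrix.mul_assoc, Matrix.trace_mul_comm]
        simp only [Matrix.mul_assoc]
      simp only
      rw [e1, hc ((a k)ᴴ * a i) (mul_mem (star_mem (haS k)) (haS i))
          (b l * (b j)ᴴ) (mul_mem (hbT l) (star_mem (hbT j))),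
        Matrix.conjTranspose_mul, Matrix.conjTranspose_conjTranspose, hao,
        Matrix.trace_mul_comm (b l), hbo]
      by_cases h1 : i = k <;> by_cases h2 : j = l <;> simp [h1, h2]) Y
  have s1 : ∑ k : ι × ι, (a k.1 * b k.2) * Y * (a k.1 * b k.2)ᴴ = ∑ i, a i * Y * (a i)ᴴ := by
    rw [Fintype.sum_prod_type]
    refine Finset.sum_congr rfl fun i _ => ?_
    calc ∑ j, (a i * b j) * Y * (a i * b j)ᴴ = ∑ j, a i * Y * (b j * (b j)ᴴ) * (a i)ᴴ := by
          refine Finset.sum_congr rfl fun j _ => ?_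
          rw [Matrix.conjTranspose_mul, Matrix.mul_assoc (a i) (b j) Y, hY _ (hbT j)]
          simp only [Matrix.mul_assoc]
      _ = _ := by rw [← Finset.sum_mul, ← Finset.mul_sum, hb2, mul_one]
  rw [s1] at key
  have hX' : ∀ A ∈ S, A * Xᴴ = Xᴴ * A := by
    intro A hA
    have := congrArg Matrix.conjTranspose (hX (star A) (star_mem hA))
    simpa [Matrix.star_eq_conjTranspose] using this.symm
  have s2 : (Xᴴ * ∑ i, a i * Y * (a i)ᴴ).trace = (Xᴴ * Y).trace := by
    calc (Xᴴ * ∑ i, a i * Y * (a i)ᴴ).trace = ∑ i, (Xᴴ * ((a i)ᴴ * a i) * Y).trace := by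
          rw [Finset.mul_sum, Matrix.trace_sum]
          refine Finset.sum_congr rfl fun i _ => ?_
          rw [← Matrix.mul_assoc, Matrix.trace_mul_comm, ← Matrix.mul_assoc, ← Matrix.mul_assoc,
            ← Matrix.mul_assoc, hX' (a i)ᴴ (star_mem (haS i))]
      _ = _ := by
          rw [← Matrix.trace_sum, ← Finset.sum_mul, ← Finset.mul_sum, ha1, mul_one]
  have key2 := congrArg (fun Z => (Xᴴ * Z).trace) key
  simp only [Matrix.mul_smul, Matrix.trace_smul, s2, smul_eq_mul, mul_one] at key2
  rw [eq_div_iff hN, mul_comm, key2, mul_comm]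

lemma frame_of_F (n : ℕ) (hn : 0 < n)
    (S : StarSubalgebra ℂ (Matrix (Fin n × Fin n) (Fin n × Fin n) ℂ))
    (φ : S ≃⋆ₐ[ℂ] Matrix (Fin n) (Fin n) ℂ) :
    HasGoodFrame (S : Set (Matrix (Fin n × Fin n) (Fin n × Fin n) ℂ)) := by
  have hn0 : (n : ℂ) ≠ 0 := by exact_mod_cast hn.ne'
  let E : Fin n → Fin n → Matrix (Fin n × Fin n) (Fin n × Fin n) ℂ :=
    fun i j => (φ.symm (Matrix.single i j 1) : S)
  have hEmul : ∀ i j k l, E i j * E k l = if j = k then E i l else 0 := by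
    intro i j k l
    have : E i j * E k l = ((φ.symm (Matrix.single i j 1 * Matrix.single k l 1) : S) :
      Matrix (Fin n × Fin n) (Fin n × Fin n) ℂ) := by
      rw [map_mul]; rfl
    rw [this]
    split_ifs with h
    · subst h; simp [E]
    · rw [Matrix.single_mul_single_of_ne _ _ _ _ h, map_zero]; rfl
  have hEstar : ∀ i j, (E i j)ᴴ = E j i := by
    intro i j
    have : (E i j)ᴴ = ((φ.symm (star (Matrix.single i j 1)) : S) :
      Matrix (Fin n × Fin n) (Fin n × Fin n) ℂ) := by
      rw [map_star]; rfl
    rw [this, Matrix.star_eq_conjTranspose, Matrix.conjTranspose_single, star_one]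
  have hEsum : ∑ i, E i i = 1 := by
    have : ∑ i, E i i = ((φ.symm (∑ i, Matrix.single i i 1) : S) :
      Matrix (Fin n × Fin n) (Fin n × Fin n) ℂ) := by
      rw [map_sum]; simp [E]
    rw [this, show ∑ i : Fin n, Matrix.single i i (1 : ℂ) = 1 by
      exact Matrix.sum_single_one
      , map_one]; rfl
  have hEtr : ∀ i j, (E i j).trace = if i = j then (n : ℂ) else 0 := by
    have hd : ∀ i j, (E i i).trace = (E j j).trace := by
      intro i j
      have h1 := hEmul i j j i
      have h2 := hEmul j i i j
      simp only [if_true] at h1 h2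
      rw [← h1, ← h2, Matrix.trace_mul_comm]
    have hs := congrArg Matrix.trace hEsum
    rw [Matrix.trace_sum] at hs
    intro i j
    split_ifs with h
    · subst h
      rw [Finset.sum_congr rfl fun j _ => hd j i] at hs
      simp at hs
      exact hs.resolve_right hn.ne'
    · have h1 := hEmul i i i j
      have h2 := hEmul i j i i
      rw [if_pos rfl] at h1
      rw [if_neg (Ne.symm h)] at h2
      rw [← h1, Matrix.trace_mul_comm, h2, Matrix.trace_zero]
  obtain ⟨c, hc⟩ : ∃ c : ℝ, (c : ℂ) * c = (n : ℂ)⁻¹ := by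
    refine ⟨Real.sqrt ((n : ℝ)⁻¹), ?_⟩
    rw [← Complex.ofReal_mul, Real.mul_self_sqrt (by positivity)]
    simp
  have hst : ∀ i j, ((c : ℂ) • E i j)ᴴ = (c : ℂ) • E j i := by
    intro i j
    rw [Matrix.conjTranspose_smul, hEstar]; simp
  refine ⟨fun p => (c : ℂ) • E p.1 p.2, ?_, ?_, ?_, ?_⟩
  · intro p
    exact S.toSubalgebra.smul_mem (Subtype.property _) _
  · rintro ⟨i, j⟩ ⟨k, l⟩
    simp only [hst, Matrix.smul_mul, Matrix.mul_smul, smul_smul, hc, hEmul, Matrix.trace_smul]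
    by_cases h1 : i = k <;> by_cases h2 : j = l <;> simp [h1, h2, hEtr, hn0]
  · simp only [hst, Matrix.smul_mul, Matrix.mul_smul, smul_smul, hc, hEmul, if_true,
      Fintype.sum_prod_type, ← Finset.smul_sum, hEsum]
    simp [← Nat.cast_smul_eq_nsmul ℂ, hn0]
  · simp only [hst, Matrix.smul_mul, Matrix.mul_smul, smul_smul, hc, hEmul, if_true,
      Fintype.sum_prod_type, Finset.sum_const, ← Finset.smul_sum, hEsum]
    simp [← Nat.cast_smul_eq_nsmul ℂ, hn0]

/-- Simultaneous unitary diagonalization of a commutative star subalgebra. -/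
lemma exists_diag {ι : Type*} [Fintype ι] [DecidableEq ι]
    (S : StarSubalgebra ℂ (Matrix ι ι ℂ)) (hS : ∀ A ∈ S, ∀ B ∈ S, A * B = B * A) :
    ∃ V : Matrix ι ι ℂ, Vᴴ * V = 1 ∧ V * Vᴴ = 1 ∧
      ∀ A ∈ S, ∃ d : ι → ℂ, A * V = V * Matrix.diagonal d := by
  classical
  let J := {H : Matrix ι ι ℂ // H ∈ S ∧ H.IsHermitian}
  let T : J → EuclideanSpace ℂ ι →ₗ[ℂ] EuclideanSpace ℂ ι := fun H => Matrix.toEuclideanLin H.1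
  have hT : ∀ H, (T H).IsSymmetric := fun H => Matrix.isSymmetric_toEuclideanLin_iff.2 H.2.2
  have hC : Pairwise (Function.onFun Commute T) := by
    intro H K _
    change T H * T K = T K * T H
    ext1 x
    have := hS _ H.2.1 _ K.2.1
    simp [T, Matrix.toLpLin_apply, this]
  have hI0 := LinearMap.IsSymmetric.directSum_isInternal_of_pairwise_commute hT hC
  have hO0 := LinearMap.IsSymmetric.orthogonalFamily_iInf_eigenspaces hT
  have : Fintype {χ : J → ℂ // (⨅ j, Module.End.eigenspace (T j) (χ j)) ≠ ⊥} :=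
    hO0.independent.fintypeNeBotOfFiniteDimensional
  have hI := DirectSum.isInternal_ne_bot_iff.2 hI0
  have hO := hO0.comp (γ := {χ : J → ℂ // (⨅ j, Module.End.eigenspace (T j) (χ j)) ≠ ⊥})
    Subtype.val_injective
  have hfr : Module.finrank ℂ (EuclideanSpace ℂ ι) = Fintype.card ι := finrank_euclideanSpace
  let e : Fin (Fintype.card ι) ≃ ι := (Fintype.equivFin ι).symm
  let b := (hI.subordinateOrthonormalBasis hfr hO).reindex e
  have hb : ∀ q, ∃ χ : J → ℂ, ∀ H : J, T H (b q) = χ H • b q := by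
    intro q
    have h := hI.subordinateOrthonormalBasis_subordinate hfr (e.symm q) hO
    rw [Submodule.mem_iInf] at h
    refine ⟨(hI.subordinateOrthonormalBasisIndex hfr (e.symm q) hO).1, fun H => ?_⟩
    have := Module.End.mem_eigenspace_iff.1 (h H)
    simpa [b] using this
  choose χ hχ using hb
  let V : Matrix ι ι ℂ := Matrix.of fun p q => b q p
  have hV : Vᴴ * V = 1 := by
    ext p q
    have := orthonormal_iff_ite.1 b.orthonormal p q
    rw [Matrix.one_apply, ← this]
    simp [Matrix.mul_apply, V, PiLp.inner_apply, mul_comm]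
  have hH : ∀ H : J, H.1 * V = V * Matrix.diagonal (fun q => χ q H) := by
    intro H
    ext p q
    have := congrArg (fun x : EuclideanSpace ℂ ι => x p) (hχ q H)
    simp [T, Matrix.toLpLin_apply, Matrix.mulVec, dotProduct] at this
    simp [Matrix.mul_apply, V, Matrix.diagonal_apply, this]
    ring
  refine ⟨V, hV, mul_eq_one_comm.1 hV, fun A hA => ?_⟩
  have hAs : Aᴴ ∈ S := star_mem hA
  let H : J := ⟨A + Aᴴ, add_mem hA hAs, by
    simp [Matrix.IsHermitian, add_comm]⟩
  let K : J := ⟨Complex.I • (A - Aᴴ), S.toSubalgebra.smul_mem (sub_mem hA hAs) _, by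
    simp [Matrix.IsHermitian, Matrix.conjTranspose_smul, smul_sub]
    abel⟩
  refine ⟨fun q => (1 / 2 : ℂ) * (χ q H - Complex.I * χ q K), ?_⟩
  have hAe : A = (1 / 2 : ℂ) • (H.1 - Complex.I • K.1) := by
    simp only [H, K, smul_smul, Complex.I_mul_I]
    module
  have : Matrix.diagonal (fun q => (1 / 2 : ℂ) * (χ q H - Complex.I * χ q K)) =
      (1 / 2 : ℂ) • (Matrix.diagonal (fun q => χ q H) -
        Complex.I • Matrix.diagonal (fun q => χ q K)) := by
    ext p q
    by_cases h : p = q <;> simp [h]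
  rw [this]
  conv_lhs => rw [hAe]
  simp only [Matrix.smul_mul, Matrix.mul_smul, Matrix.sub_mul, Matrix.mul_sub, hH]

lemma frame_of_masa {ι : Type*} [Fintype ι] [DecidableEq ι]
    (S : StarSubalgebra ℂ (Matrix ι ι ℂ))
    (hS : matCommutant (S : Set (Matrix ι ι ℂ)) = S) :
    HasGoodFrame (S : Set (Matrix ι ι ℂ)) := by
  have hcomm : ∀ A ∈ S, ∀ B ∈ S, A * B = B * A := by
    intro A hA B hB
    have hB' : B ∈ matCommutant (S : Set (Matrix ι ι ℂ)) := by rw [hS]; exact hB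
    exact hB' A hA
  obtain ⟨V, hV1, hV2, hd⟩ := exists_diag S hcomm
  have hst : ∀ q, (V * Matrix.single q q 1 * Vᴴ)ᴴ = V * Matrix.single q q 1 * Vᴴ := by
    intro q
    simp [Matrix.conjTranspose_mul, Matrix.mul_assoc]
  have hmul : ∀ p q, (V * Matrix.single p p 1 * Vᴴ) * (V * Matrix.single q q 1 * Vᴴ) =
      V * (Matrix.single p p 1 * Matrix.single q q 1) * Vᴴ := by
    intro p q
    calc _ = V * Matrix.single p p 1 * (Vᴴ * V) * Matrix.single q q 1 * Vᴴ := by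
          simp only [Matrix.mul_assoc]
      _ = _ := by rw [hV1, mul_one]; simp only [Matrix.mul_assoc]
  have hsum : ∑ q, V * Matrix.single q q 1 * Vᴴ = 1 := by
    rw [← Finset.sum_mul, ← Finset.mul_sum,
      show ∑ i : ι, Matrix.single i i (1 : ℂ) = 1 by
        exact Matrix.sum_single_one
      , mul_one, hV2]
  refine ⟨fun q => V * Matrix.single q q 1 * Vᴴ, ?_, ?_, ?_, ?_⟩
  · intro q
    rw [← hS]
    intro A hA
    obtain ⟨d, hd⟩ := hd A hA
    have hd2 : Vᴴ * A = Matrix.diagonal d * Vᴴ := by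
      calc Vᴴ * A = Vᴴ * (A * V) * Vᴴ := by
            rw [Matrix.mul_assoc, Matrix.mul_assoc A, hV2, mul_one]
        _ = _ := by rw [hd, ← Matrix.mul_assoc, hV1, one_mul]
    rw [← Matrix.mul_assoc, ← Matrix.mul_assoc, hd, Matrix.mul_assoc _ Vᴴ A, hd2,
      Matrix.mul_assoc V, ← Matrix.mul_assoc _ _ Vᴴ, Matrix.mul_assoc V (Matrix.single q q 1)]
    congr 2
    ext i j
    simp [Matrix.single_apply]
    grind
  · intro i j
    simp only [hst, hmul]
    rw [Matrix.trace_mul_comm, ← Matrix.mul_assoc, hV1, one_mul]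
    split_ifs with h
    · subst h; simp
    · rw [Matrix.single_mul_single_of_ne _ _ _ _ h, Matrix.trace_zero]
  · simp only [hst, hmul, Matrix.single_mul_single_same, mul_one, hsum]
  · simp only [hst, hmul, Matrix.single_mul_single_same, mul_one, hsum]

/-- If 𝒜₁ and 𝒜₂ are complementary subalgebras of M_n ⊗ M_n ≅ M_{n²}, each either
an F-subalgebra (isomorphic to M_n) or maximal abelian, then their commutants
𝒜₁′ and 𝒜₂′ are also complementary. -/
theorem commutants_complementary_of_F_or_masa (n : ℕ)
    (𝒜₁ 𝒜₂ : StarSubalgebra ℂ (Matrix (Fin n × Fin n) (Fin n × Fin n) ℂ))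
    (h1 : Nonempty (𝒜₁ ≃⋆ₐ[ℂ] Matrix (Fin n) (Fin n) ℂ)
      ∨ matCommutant (𝒜₁ : Set (Matrix (Fin n × Fin n) (Fin n × Fin n) ℂ)) = 𝒜₁)
    (h2 : Nonempty (𝒜₂ ≃⋆ₐ[ℂ] Matrix (Fin n) (Fin n) ℂ)
      ∨ matCommutant (𝒜₂ : Set (Matrix (Fin n × Fin n) (Fin n × Fin n) ℂ)) = 𝒜₂)
    (hc : Complementary (𝒜₁ : Set (Matrix (Fin n × Fin n) (Fin n × Fin n) ℂ))
      (𝒜₂ : Set (Matrix (Fin n × Fin n) (Fin n × Fin n) ℂ))) :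
    Complementary (matCommutant (𝒜₁ : Set (Matrix (Fin n × Fin n) (Fin n × Fin n) ℂ)))
      (matCommutant (𝒜₂ : Set (Matrix (Fin n × Fin n) (Fin n × Fin n) ℂ))) := by
  rcases Nat.eq_zero_or_pos n with rfl | hn
  · intro A _ B _
    simp [Matrix.trace]
  · have : Nonempty (Fin n × Fin n) := ⟨(⟨0, hn⟩, ⟨0, hn⟩)⟩
    refine commutants_of_frames 𝒜₁ 𝒜₂ ?_ ?_ hc
    · exact h1.elim (fun ⟨φ⟩ => frame_of_F n hn _ φ) (frame_of_masa _)
    · exact h2.elim (fun ⟨φ⟩ => frame_of_F n hn _ φ) (frame_of_masa _)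
end
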